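/- Neyman-orthogonality with respect to the Q-function nuisance: for all directions Δq : S×A → ℝ and Δg : S×A → ℝ, the mixed second partial derivative ∂²/∂u∂t of the map (u,t) ↦ L(πb, w*, Q_{πe} + u·Δq, Q_{πe} + t·Δg), evaluated at (u,t) = (0,0), equals 0, where the behavior-policy nuisance is the true πb and the density-ratio nuisance is the true discounted stationary density ratio w*. -/

import Mathlib

open Finset

/-- The population loss `L(b,w,q,g)`: for observations `o' = (s',a',r',s̃')` drawn from
the observational one-step distribution `p_b(o') = d_b(s')·πb(a'|s')·p_r(r'|s',a')·P(s̃'|s',a')`,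
`L(b,w,q,g) = E_{o'∼p_b}[ Σ_a πe(a|s')·(φ1(o',a) − g(s',a))² + Σ_{s,a} d_b(s)·πe(a|s)·(φ2(o',s,a) − g(s,a))² ]`
with `φ1(o',a) = 2·𝟙{a'=a}/b(s',a')·δ_q(o') + q(s',a)`,
`φ2(o',s,a) = 2·(πe(a'|s')/b(s',a'))·w(s',s,a)·δ_q(o') + q(s,a)`, and
`δ_q(o') = r' + γ·v_q(s̃') − q(s',a')`, `v_q(s̃) = Σ_ã πe(ã|s̃)·q(s̃,ã)`. -/
noncomputable def Lloss {S A : Type*} [Fintype S] [Fintype A] [DecidableEq A]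
    (R0 : Finset ℝ) (P : S → A → S → ℝ) (pr : S → A → ℝ → ℝ)
    (γ : ℝ) (πb πe : S → A → ℝ) (db : S → ℝ)
    (b : S → A → ℝ) (w : S → S → A → ℝ) (q g : S → A → ℝ) : ℝ :=
  ∑ s' : S, ∑ a' : A, ∑ r' ∈ R0, ∑ st : S,
    db s' * πb s' a' * pr s' a' r' * P s' a' st *
      ((∑ a : A, πe s' a *
          (2 * (if a' = a then (1 : ℝ) else 0) / b s' a' *
              (r' + γ * (∑ a2 : A, πe st a2 * q st a2) - q s' a') + q s' a - g s' a) ^ 2) +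
       (∑ s : S, ∑ a : A, db s * πe s a *
          (2 * (πe s' a' / b s' a') * w s' s a *
              (r' + γ * (∑ a2 : A, πe st a2 * q st a2) - q s' a') + q s a - g s a) ^ 2))

/-- Weighted squared norm `‖f‖²_{2,d_b·πe} = Σ_{s,a} d_b(s)·πe(a|s)·f(s,a)²`. -/
noncomputable def wnormSq {S A : Type*} [Fintype S] [Fintype A]
    (db : S → ℝ) (πe : S → A → ℝ) (f : S → A → ℝ) : ℝ :=
  ∑ s : S, ∑ a : A, db s * πe s a * f s a ^ 2

/-- `t+1`-step state distribution `p_π^{t+1}(s'|s,a)`. -/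
noncomputable def pstep {S A : Type*} [Fintype S] [Fintype A]
    (P : S → A → S → ℝ) (π : S → A → ℝ) : ℕ → S → A → S → ℝ
  | 0 => P
  | (t + 1) => fun s a s' =>
      ∑ s'' : S, ∑ a'' : A, pstep P π t s a s'' * π s'' a'' * P s'' a'' s'

/-- The true discounted stationary density ratio
`w*(s',s,a) = (Σ_{t≥1} γ^t·p_{πe}^t(s'|s,a)) / d_b(s')`. -/
noncomputable def wstar {S A : Type*} [Fintype S] [Fintype A]
    (P : S → A → S → ℝ) (πe : S → A → ℝ) (γ : ℝ) (db : S → ℝ)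
    (s' s : S) (a : A) : ℝ :=
  (∑' t : ℕ, γ ^ (t + 1) * pstep P πe t s a s') / db s'


lemma pstep_nonneg_aux {S A : Type*} [Fintype S] [Fintype A]
    (P : S → A → S → ℝ) (hP0 : ∀ s a s', 0 ≤ P s a s')
    (π : S → A → ℝ) (hπ0 : ∀ s a, 0 ≤ π s a) (t : ℕ) :
    ∀ s a s', 0 ≤ pstep P π t s a s' := by
  induction t with
  | zero => exact hP0
  | succ t ih =>
    intro s a s'
    exact sum_nonneg fun x _ => sum_nonneg fun y _ =>
      mul_nonneg (mul_nonneg (ih _ _ _) (hπ0 _ _)) (hP0 _ _ _)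

lemma pstep_sum_aux {S A : Type*} [Fintype S] [Fintype A]
    (P : S → A → S → ℝ) (hP1 : ∀ s a, ∑ s' : S, P s a s' = 1)
    (π : S → A → ℝ) (hπ1 : ∀ s, ∑ a : A, π s a = 1) (t : ℕ) :
    ∀ s a, ∑ s', pstep P π t s a s' = 1 := by
  induction t with
  | zero => exact hP1
  | succ t ih =>
    intro s a
    simp only [pstep]
    rw [sum_comm]
    rw [← ih s a]
    refine sum_congr rfl fun x _ => ?_
    rw [sum_comm]
    simp only [← mul_sum, hP1, hπ1, mul_one]

lemma summable_aux {S A : Type*} [Fintype S] [Fintype A]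
    (P : S → A → S → ℝ) (hP0 : ∀ s a s', 0 ≤ P s a s')
    (hP1 : ∀ s a, ∑ s' : S, P s a s' = 1)
    (π : S → A → ℝ) (hπ0 : ∀ s a, 0 ≤ π s a) (hπ1 : ∀ s, ∑ a : A, π s a = 1)
    (γ : ℝ) (hγ0 : 0 < γ) (hγ1 : γ < 1) (s : S) (a : A) (s' : S) :
    Summable fun t : ℕ => γ ^ (t + 1) * pstep P π t s a s' := by
  refine Summable.of_nonneg_of_le
    (fun t => mul_nonneg (pow_nonneg hγ0.le _) (pstep_nonneg_aux P hP0 π hπ0 t s a s'))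
    (fun t => ?_) (summable_geometric_of_lt_one hγ0.le hγ1)
  have h1 : pstep P π t s a s' ≤ 1 := by
    rw [← pstep_sum_aux P hP1 π hπ1 t s a]
    exact single_le_sum (f := fun x => pstep P π t s a x)
      (fun x _ => pstep_nonneg_aux P hP0 π hπ0 t s a x) (mem_univ s')
  have h2 : γ ^ (t + 1) ≤ γ ^ t := pow_le_pow_of_le_one hγ0.le hγ1.le (Nat.le_succ t)
  have h3 : 0 ≤ γ ^ (t + 1) := pow_nonneg hγ0.le _
  nlinarith

/-- flow equation of the discounted occupancy -/
lemma flow_aux {S A : Type*} [Fintype S] [Fintype A]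
    (P : S → A → S → ℝ) (hP0 : ∀ s a s', 0 ≤ P s a s')
    (hP1 : ∀ s a, ∑ s' : S, P s a s' = 1)
    (π : S → A → ℝ) (hπ0 : ∀ s a, 0 ≤ π s a) (hπ1 : ∀ s, ∑ a : A, π s a = 1)
    (γ : ℝ) (hγ0 : 0 < γ) (hγ1 : γ < 1) (s : S) (a : A) (s' : S) :
    (∑' t : ℕ, γ ^ (t + 1) * pstep P π t s a s') = γ * P s a s' +
      γ * ∑ x, ∑ y, (∑' t : ℕ, γ ^ (t + 1) * pstep P π t s a x) * π x y * P x y s' := by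
  have hs := summable_aux P hP0 hP1 π hπ0 hπ1 γ hγ0 hγ1 s a
  rw [(hs s').tsum_eq_zero_add]
  congr 1
  · simp [pstep]
  · have : HasSum (fun t : ℕ => γ * ∑ x, ∑ y, (γ ^ (t + 1) * pstep P π t s a x) * π x y * P x y s')
        (γ * ∑ x, ∑ y, (∑' t : ℕ, γ ^ (t + 1) * pstep P π t s a x) * π x y * P x y s') := by
      refine HasSum.mul_left _ (hasSum_sum fun x _ => hasSum_sum fun y _ => ?_)
      exact ((hs x).hasSum.mul_right _).mul_right _
    rw [← this.tsum_eq]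
    refine tsum_congr fun t => ?_
    simp only [pstep, mul_sum]
    refine sum_congr rfl fun x _ => sum_congr rfl fun y _ => ?_
    ring

/-- the occupancy-weighted temporal differences telescope -/
lemma telescope_aux {S A : Type*} [Fintype S] [Fintype A]
    (P : S → A → S → ℝ) (π : S → A → ℝ) (γ : ℝ) (f : S → A → ℝ) (p W : S → ℝ)
    (hW : ∀ s', W s' = γ * p s' + γ * ∑ x, ∑ y, W x * π x y * P x y s') :
    ∑ x, ∑ y, W x * π x y * (γ * (∑ z, P x y z * ∑ c, π z c * f z c) - f x y)
      = - (γ * ∑ z, p z * ∑ c, π z c * f z c) := by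
  set v : S → ℝ := fun z => ∑ c, π z c * f z c with hv
  have h1 : ∑ z, W z * v z = γ * ∑ z, p z * v z
      + ∑ x, ∑ y, W x * π x y * (γ * (∑ z, P x y z * v z)) := by
    calc ∑ z, W z * v z
        = ∑ z, (γ * p z + γ * ∑ x, ∑ y, W x * π x y * P x y z) * v z :=
          sum_congr rfl fun z _ => by rw [← hW z]
      _ = γ * ∑ z, p z * v z + ∑ z, ∑ x, ∑ y, W x * π x y * (γ * (P x y z * v z)) := by
          rw [mul_sum, ← sum_add_distrib]
          refine sum_congr rfl fun z _ => ?_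
          rw [add_mul, mul_assoc]
          congr 1
          simp only [mul_sum, sum_mul]
          refine sum_congr rfl fun x _ => sum_congr rfl fun y _ => ?_
          ring
      _ = _ := by
          congr 1
          rw [sum_comm]
          refine sum_congr rfl fun x _ => ?_
          rw [sum_comm]
          refine sum_congr rfl fun y _ => ?_
          simp only [mul_sum]
  have h2 : ∑ z, W z * v z = ∑ x, ∑ y, W x * π x y * f x y := by
    refine sum_congr rfl fun x _ => ?_
    simp only [hv, mul_sum, mul_assoc]
  simp only [mul_sub, sum_sub_distrib]
  rw [← h2, h1]
  ring

/-- coefficient of `u t` in the loss -/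
noncomputable def mixedCoef {S A : Type*} [Fintype S] [Fintype A] [DecidableEq A]
    (R0 : Finset ℝ) (P : S → A → S → ℝ) (pr : S → A → ℝ → ℝ)
    (γ : ℝ) (πb πe : S → A → ℝ) (db : S → ℝ)
    (b : S → A → ℝ) (w : S → S → A → ℝ) (dq dg : S → A → ℝ) : ℝ :=
  ∑ s' : S, ∑ a' : A, ∑ r' ∈ R0, ∑ st : S,
    db s' * πb s' a' * pr s' a' r' * P s' a' st *
      ((∑ a : A, πe s' a * (-2 * dg s' a *
          (2 * (if a' = a then (1 : ℝ) else 0) / b s' a' *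
              (γ * (∑ a2 : A, πe st a2 * dq st a2) - dq s' a') + dq s' a))) +
       (∑ s : S, ∑ a : A, db s * πe s a * (-2 * dg s a *
          (2 * (πe s' a' / b s' a') * w s' s a *
              (γ * (∑ a2 : A, πe st a2 * dq st a2) - dq s' a') + dq s a))))

lemma Lloss_expand {S A : Type*} [Fintype S] [Fintype A] [DecidableEq A]
    (R0 : Finset ℝ) (P : S → A → S → ℝ) (pr : S → A → ℝ → ℝ)
    (γ : ℝ) (πb πe : S → A → ℝ) (db : S → ℝ)
    (b : S → A → ℝ) (w : S → S → A → ℝ) (q g dq dg : S → A → ℝ) :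
    ∃ (c : ℝ → ℝ) (B C : ℝ), ∀ u t : ℝ,
      Lloss R0 P pr γ πb πe db b w (fun s a => q s a + u * dq s a)
        (fun s a => g s a + t * dg s a)
      = c u + t * B + t * u * mixedCoef R0 P pr γ πb πe db b w dq dg + t ^ 2 * C := by
  refine ⟨fun u => Lloss R0 P pr γ πb πe db b w (fun s a => q s a + u * dq s a) g,
    ∑ s' : S, ∑ a' : A, ∑ r' ∈ R0, ∑ st : S,
    db s' * πb s' a' * pr s' a' r' * P s' a' st *
      ((∑ a : A, πe s' a * (-2 * dg s' a *
          (2 * (if a' = a then (1 : ℝ) else 0) / b s' a' *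
              (r' + γ * (∑ a2 : A, πe st a2 * q st a2) - q s' a') + q s' a - g s' a))) +
       (∑ s : S, ∑ a : A, db s * πe s a * (-2 * dg s a *
          (2 * (πe s' a' / b s' a') * w s' s a *
              (r' + γ * (∑ a2 : A, πe st a2 * q st a2) - q s' a') + q s a - g s a)))),
    ∑ s' : S, ∑ a' : A, ∑ r' ∈ R0, ∑ st : S,
    db s' * πb s' a' * pr s' a' r' * P s' a' st *
      ((∑ a : A, πe s' a * dg s' a ^ 2) + (∑ s : S, ∑ a : A, db s * πe s a * dg s a ^ 2)),
    fun u t => ?_⟩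
  have hv : ∀ st, ∑ a2 : A, πe st a2 * (q st a2 + u * dq st a2)
      = (∑ a2 : A, πe st a2 * q st a2) + u * ∑ a2 : A, πe st a2 * dq st a2 := by
    intro st
    rw [mul_sum, ← sum_add_distrib]
    exact sum_congr rfl fun _ _ => by ring
  simp only [Lloss, mixedCoef, hv]
  simp only [mul_sum _ _ (t * u), mul_sum _ _ (t ^ 2), mul_sum _ _ t, ← sum_add_distrib]
  refine sum_congr rfl fun s' _ => sum_congr rfl fun a' _ => sum_congr rfl fun r' _ =>
    sum_congr rfl fun st _ => ?_
  generalize (∑ a2 : A, πe st a2 * q st a2) = v1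
  generalize (∑ a2 : A, πe st a2 * dq st a2) = v2
  generalize db s' * πb s' a' * pr s' a' r' * P s' a' st = k
  have e1 : ∀ X1 X2 B1 B2 M1 M2 C1 C2 : ℝ,
      k * (X1 + X2) + t * (k * (B1 + B2)) + t * u * (k * (M1 + M2)) + t ^ 2 * (k * (C1 + C2))
      = k * ((X1 + t * B1 + t * u * M1 + t ^ 2 * C1) + (X2 + t * B2 + t * u * M2 + t ^ 2 * C2)) := by
    intros; ring
  rw [e1]
  congr 2
  · simp only [mul_sum, ← sum_add_distrib]
    refine sum_congr rfl fun a _ => ?_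
    ring
  · simp only [mul_sum, ← sum_add_distrib]
    refine sum_congr rfl fun s _ => sum_congr rfl fun a _ => ?_
    ring

/-- integrate out the reward and next state -/
lemma inner_aux {S : Type*} [Fintype S] (R0 : Finset ℝ) (P : S → ℝ) (pr : ℝ → ℝ)
    (hpr1 : ∑ r ∈ R0, pr r = 1) (k : ℝ) (F : S → ℝ) :
    ∑ r ∈ R0, ∑ st, k * pr r * P st * F st = k * ∑ st, P st * F st := by
  have : ∀ r ∈ R0, ∑ st, k * pr r * P st * F st = pr r * (k * ∑ st, P st * F st) := by
    intro r _
    simp only [mul_sum]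
    exact sum_congr rfl fun _ _ => by ring
  rw [sum_congr rfl this, ← sum_mul, hpr1, one_mul]

lemma avg_aux {S : Type*} [Fintype S] (P : S → ℝ) (hP1 : ∑ s, P s = 1)
    (α β γ d e : ℝ) (v : S → ℝ) :
    ∑ st, P st * (α * (β * (γ * v st - d) + e))
      = α * (β * (γ * (∑ st, P st * v st) - d) + e) := by
  have : ∀ st, P st * (α * (β * (γ * v st - d) + e))
      = α * β * γ * (P st * v st) + P st * (α * (e - β * d)) := by intro st; ring
  simp only [this, sum_add_distrib, ← mul_sum, ← sum_mul, hP1]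
  ring

lemma mixedCoef_zero {S A : Type*} [Fintype S] [Fintype A] [DecidableEq A]
    (R0 : Finset ℝ) (P : S → A → S → ℝ) (hP1 : ∀ s a, ∑ s' : S, P s a s' = 1)
    (pr : S → A → ℝ → ℝ) (hpr1 : ∀ s a, ∑ r ∈ R0, pr s a r = 1)
    (γ : ℝ) (πb πe : S → A → ℝ) (hπb0 : ∀ s a, 0 < πb s a) (hπb1 : ∀ s, ∑ a : A, πb s a = 1)
    (db : S → ℝ) (hdb0 : ∀ s, 0 < db s) (hdb1 : ∑ s : S, db s = 1)
    (W : S → S → A → ℝ)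
    (hW : ∀ s a s', W s' s a = γ * P s a s' + γ * ∑ x, ∑ y, W x s a * πe x y * P x y s')
    (dq dg : S → A → ℝ) :
    mixedCoef R0 P pr γ πb πe db πb (fun s' s a => W s' s a / db s') dq dg = 0 := by
  have tel := fun s a => telescope_aux P πe γ dq (P s a) (fun x => W x s a) (hW s a)
  unfold mixedCoef
  set v : S → ℝ := fun z => ∑ c, πe z c * dq z c with hv
  set h : S → A → ℝ := fun x y => γ * (∑ z, P x y z * v z) - dq x y with hh
  have step1 : ∀ s' a', ∑ r' ∈ R0, ∑ st : S,
      db s' * πb s' a' * pr s' a' r' * P s' a' st *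
      ((∑ a : A, πe s' a * (-2 * dg s' a *
          (2 * (if a' = a then (1 : ℝ) else 0) / πb s' a' *
              (γ * v st - dq s' a') + dq s' a))) +
       (∑ s : S, ∑ a : A, db s * πe s a * (-2 * dg s a *
          (2 * (πe s' a' / πb s' a') * (W s' s a / db s') *
              (γ * v st - dq s' a') + dq s a))))
      = (∑ a : A, db s' * πb s' a' * (πe s' a * (-2 * dg s' a) *
          (2 * (if a' = a then (1 : ℝ) else 0) / πb s' a' * h s' a' + dq s' a))) +
       (∑ s : S, ∑ a : A, db s * πe s a * (-2 * dg s a) *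
          (2 * (W s' s a * πe s' a' * h s' a') + db s' * πb s' a' * dq s a)) := by
    intro s' a'
    rw [inner_aux R0 (P s' a') (pr s' a') (hpr1 s' a')]
    simp only [mul_add (P s' a' _), sum_add_distrib]
    simp only [mul_sum (univ : Finset A) _ (P s' a' _), mul_sum (univ : Finset S) _ (P s' a' _)]
    rw [mul_add (db s' * πb s' a')]
    congr 1
    · rw [sum_comm, mul_sum]
      refine sum_congr rfl fun a _ => ?_
      simp only [← mul_assoc (πe s' a)]
      rw [avg_aux _ (hP1 s' a')]
    · rw [sum_comm, mul_sum]
      refine sum_congr rfl fun s _ => ?_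
      rw [sum_comm, mul_sum]
      refine sum_congr rfl fun a _ => ?_
      simp only [← mul_assoc (db s * πe s a)]
      rw [avg_aux _ (hP1 s' a')]
      have h1 := (hπb0 s' a').ne'
      have h2 := (hdb0 s').ne'
      simp only [hh]
      field_simp
  have e1 : ∀ s', ∑ a', ∑ a : A, db s' * πb s' a' * (πe s' a * (-2 * dg s' a) *
          (2 * (if a' = a then (1 : ℝ) else 0) / πb s' a' * h s' a' + dq s' a))
      = ∑ a, db s' * πe s' a * (-2 * dg s' a) * (2 * h s' a + dq s' a) := by
    intro s'
    rw [sum_comm]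
    refine sum_congr rfl fun a _ => ?_
    have : ∀ a', db s' * πb s' a' * (πe s' a * (-2 * dg s' a) *
          (2 * (if a' = a then (1 : ℝ) else 0) / πb s' a' * h s' a' + dq s' a))
        = (if a' = a then db s' * πe s' a * (-2 * dg s' a) * (2 * h s' a) else 0)
          + πb s' a' * (db s' * πe s' a * (-2 * dg s' a) * dq s' a) := by
      intro a'
      have h1 := (hπb0 s' a').ne'
      split_ifs with hc
      · subst hc
        field_simp
        ring
      · simp
        ring
    simp only [this, sum_add_distrib, ← sum_mul, hπb1, sum_ite_eq', mem_univ, if_true]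
    ring
  have e2 : ∑ s', ∑ a', ∑ s : S, ∑ a : A, db s * πe s a * (-2 * dg s a) *
          (2 * (W s' s a * πe s' a' * h s' a') + db s' * πb s' a' * dq s a)
      = ∑ s, ∑ a, db s * πe s a * (-2 * dg s a) *
          (2 * (-(γ * ∑ z, P s a z * v z)) + dq s a) := by
    have : ∀ s a, db s * πe s a * (-2 * dg s a) *
          (2 * (-(γ * ∑ z, P s a z * v z)) + dq s a)
        = ∑ s', ∑ a', db s * πe s a * (-2 * dg s a) *
          (2 * (W s' s a * πe s' a' * h s' a') + db s' * πb s' a' * dq s a) := by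
      intro s a
      simp only [← mul_sum, sum_add_distrib, ← sum_mul, hπb1, mul_one, hdb1, one_mul]
      rw [← tel s a]
    simp only [this]
    calc _ = ∑ s', ∑ s, ∑ a', ∑ a, db s * πe s a * (-2 * dg s a) *
          (2 * (W s' s a * πe s' a' * h s' a') + db s' * πb s' a' * dq s a) :=
            sum_congr rfl fun _ _ => sum_comm
      _ = ∑ s, ∑ s', ∑ a', ∑ a, db s * πe s a * (-2 * dg s a) *
          (2 * (W s' s a * πe s' a' * h s' a') + db s' * πb s' a' * dq s a) := sum_comm
      _ = ∑ s, ∑ s', ∑ a, ∑ a', db s * πe s a * (-2 * dg s a) *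
          (2 * (W s' s a * πe s' a' * h s' a') + db s' * πb s' a' * dq s a) :=
            sum_congr rfl fun _ _ => sum_congr rfl fun _ _ => sum_comm
      _ = _ := sum_congr rfl fun _ _ => sum_comm
  refine (sum_congr rfl fun s' _ => sum_congr rfl fun a' _ => step1 s' a').trans ?_
  simp only [sum_add_distrib]
  simp only [e1]
  rw [e2, ← sum_add_distrib]
  refine sum_eq_zero fun s _ => ?_
  rw [← sum_add_distrib]
  refine sum_eq_zero fun a _ => ?_
  simp only [hh]
  ring

/-- Neyman-orthogonality w.r.t. the Q-function nuisance:
the mixed second partial derivative `∂²/∂u∂t` at `(0,0)` of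
`(u,t) ↦ L(πb, w*, Q_{πe} + u·Δq, Q_{πe} + t·Δg)` equals `0`, where the
behavior-policy nuisance is the true `πb` and the density-ratio nuisance is the
true discounted stationary density ratio `w*`. -/
theorem neyman_orthogonality_Q_nuisance
    (S A : Type*) [Fintype S] [Fintype A] [Nonempty S] [Nonempty A] [DecidableEq A]
    (R0 : Finset ℝ)
    (P : S → A → S → ℝ) (hP0 : ∀ s a s', 0 ≤ P s a s')
    (hP1 : ∀ s a, ∑ s' : S, P s a s' = 1)
    (pr : S → A → ℝ → ℝ) (hpr0 : ∀ s a, ∀ r ∈ R0, 0 ≤ pr s a r)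
    (hpr1 : ∀ s a, ∑ r ∈ R0, pr s a r = 1)
    (rbar : S → A → ℝ) (hrbar : ∀ s a, rbar s a = ∑ r ∈ R0, r * pr s a r)
    (γ : ℝ) (hγ0 : 0 < γ) (hγ1 : γ < 1)
    (πb : S → A → ℝ) (hπb0 : ∀ s a, 0 < πb s a) (hπb1 : ∀ s, ∑ a : A, πb s a = 1)
    (πe : S → A → ℝ) (hπe0 : ∀ s a, 0 ≤ πe s a) (hπe1 : ∀ s, ∑ a : A, πe s a = 1)
    (db : S → ℝ) (hdb0 : ∀ s, 0 < db s) (hdb1 : ∑ s : S, db s = 1)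
    (Q : S → A → ℝ)
    (hQ : ∀ s a, Q s a =
      rbar s a + γ * ∑ s' : S, P s a s' * ∑ a' : A, πe s' a' * Q s' a')
    (Δq : S → A → ℝ) (Δg : S → A → ℝ) :
    deriv (fun u : ℝ =>
      deriv (fun t : ℝ =>
        Lloss R0 P pr γ πb πe db πb (wstar P πe γ db)
          (fun s a => Q s a + u * Δq s a)
          (fun s a => Q s a + t * Δg s a)) 0) 0 = 0 := by
  obtain ⟨c, B, C, hL⟩ := Lloss_expand R0 P pr γ πb πe db πb (wstar P πe γ db) Q Q Δq Δg
  have hM : mixedCoef R0 P pr γ πb πe db πb (wstar P πe γ db) Δq Δg = 0 :=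
    mixedCoef_zero R0 P hP1 pr hpr1 γ πb πe hπb0 hπb1 db hdb0 hdb1
      (fun s' s a => ∑' t : ℕ, γ ^ (t + 1) * pstep P πe t s a s')
      (flow_aux P hP0 hP1 πe hπe0 hπe1 γ hγ0 hγ1) Δq Δg
  have hd : ∀ u : ℝ, deriv (fun t : ℝ =>
        Lloss R0 P pr γ πb πe db πb (wstar P πe γ db)
          (fun s a => Q s a + u * Δq s a)
          (fun s a => Q s a + t * Δg s a)) 0 = B := by
    intro u
    simp only [hL, hM, mul_zero, add_zero]
    have h := (((hasDerivAt_id (0 : ℝ)).mul_const B).const_add (c u)).add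
      (((hasDerivAt_id (0 : ℝ)).pow 2).mul_const C)
    have h2 := h.deriv
    simp at h2
    exact h2
  simp only [hd, deriv_const]
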